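/- arXiv:2401.15278 — 5 statements merged into one kernel-verified Lean document; each statement's English description precedes it below -/
import Mathlib

section
/- Let T ∈ ℕ₊, λ ∈ (0,1), λ̂ ∈ [λ,1), σ₁, σ₂ > 0, B̄ ≥ 0, v̄ ≥ 0. Suppose x : ℕ → ℝⁿ, A : ℕ → ℝ^{n×n}, B : ℕ → ℝ^{n×m}, ṽ : ℕ → ℝᵐ, and gains K : ℕ → ℝ^{m×n}, symmetric matrices P : ℕ → ℝ^{n×n} satisfy: (i) x(t+1) = A(t)x(t) + B(t)(K_{⌊t/T⌋} x(t) + ṽ(t)) for all t ∈ ℕ; (ii) ‖ṽ(t)‖ ≤ v̄ and ‖B(t)‖ ≤ B̄ for all t ∈ ℕ; (iii) for every i ∈ ℕ and every t with iT ≤ t < (i+1)T, (A(t) + B(t)K_i)ᵀ P_i (A(t) + B(t)K_i) ⪯ λ P_i; (iv) σ₁ I_n ⪯ P_i ⪯ σ₂ I_n for all i ∈ ℕ; (v) P_{i+1} ⪯ (λ̂/λ)^T P_i for all i ∈ ℕ. Then for all t ∈ ℕ, ‖x(t)‖ ≤ √(σ₂/σ₁) · λ̂^{t/2} ‖x(0)‖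 + √(σ₂/σ₁) · (1 − √λ̂)⁻¹ · (λ̂/λ)^{T/2} · B̄ · v̄ ; in particular the closed-loop system is practically globally exponentially stable. -/
open Matrix
open scoped Matrix.Norms.L2Operator

lemma aux_quad_nonneg {n : ℕ} {M : Matrix (Fin n) (Fin n) ℝ} (h : M.PosSemidef)
    (y : Fin n → ℝ) : 0 ≤ y ⬝ᵥ (M *ᵥ y) := by
  simpa using h.dotProduct_mulVec_nonneg y

lemma aux_norm_sq {n m : ℕ} (C : Matrix (Fin m) (Fin n) ℝ) (y : EuclideanSpace ℝ (Fin n)) :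
    ‖toEuclideanLin C y‖ ^ 2 = y.ofLp ⬝ᵥ ((Cᴴ * C) *ᵥ y.ofLp) := by
  rw [EuclideanSpace.real_norm_sq_eq, ← Matrix.mulVec_mulVec, Matrix.dotProduct_mulVec,
    Matrix.vecMul_conjTranspose]
  simp [dotProduct, pow_two, Matrix.toLpLin_apply]

lemma aux_norm_sq' {n : ℕ} (y : EuclideanSpace ℝ (Fin n)) :
    ‖y‖ ^ 2 = y.ofLp ⬝ᵥ y.ofLp := by
  rw [EuclideanSpace.real_norm_sq_eq]
  simp [dotProduct, pow_two]

lemma aux_rec (W : ℕ → ℝ) (r c : ℝ) (hr0 : 0 ≤ r) (hr1 : r < 1) (hc : 0 ≤ c)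
    (h : ∀ t, W (t + 1) ≤ r * W t + c) (t : ℕ) :
    W t ≤ r ^ t * W 0 + (1 - r)⁻¹ * c := by
  have h1 : 0 < 1 - r := by linarith
  induction t with
  | zero =>
    have : 0 ≤ (1 - r)⁻¹ * c := by positivity
    simpa using this
  | succ k ih =>
    have e : r * ((1 - r)⁻¹ * c) + c = (1 - r)⁻¹ * c := by
      field_simp
      ring
    calc W (k + 1) ≤ r * W k + c := h k
      _ ≤ r * (r ^ k * W 0 + (1 - r)⁻¹ * c) + c := by gcongr
      _ = r ^ (k + 1) * W 0 + (r * ((1 - r)⁻¹ * c) + c) := by ring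
      _ = _ := by rw [e]

lemma aux_sq_sqrt {a b c : ℝ} (hb : 0 ≤ b) (hc : 0 ≤ c)
    (h : a ^ 2 ≤ c * b ^ 2) : a ≤ √c * b := by
  refine le_trans (le_abs_self _) (abs_le_of_sq_le_sq ?_ (by positivity))
  rw [mul_pow, Real.sq_sqrt hc]
  exact h

/-- Theorem 1: stability of the closed-loop system under ODDAC.
`S₁ ⪯ S₂` is encoded as `(S₂ - S₁).PosSemidef`; vector norms are Euclidean and matrix
norms are the spectral (ℓ²-operator) norms provided by `Matrix.L2OpNorm`. -/
theorem closed_loop_pGES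
    (n m : ℕ) (hn : 0 < n) (hm : 0 < m) (T : ℕ) (hT : 0 < T)
    (lam lamhat σ₁ σ₂ Bbar vbar : ℝ)
    (hlam0 : 0 < lam) (hlam1 : lam < 1)
    (hlamhat_ge : lam ≤ lamhat) (hlamhat_lt : lamhat < 1)
    (hσ₁ : 0 < σ₁) (hσ₂ : 0 < σ₂) (hBbar : 0 ≤ Bbar) (hvbar : 0 ≤ vbar)
    (x : ℕ → EuclideanSpace ℝ (Fin n))
    (A : ℕ → Matrix (Fin n) (Fin n) ℝ) (B : ℕ → Matrix (Fin n) (Fin m) ℝ)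
    (v : ℕ → EuclideanSpace ℝ (Fin m))
    (K : ℕ → Matrix (Fin m) (Fin n) ℝ) (P : ℕ → Matrix (Fin n) (Fin n) ℝ)
    (hPsymm : ∀ i, (P i).IsSymm)
    -- (i) closed-loop dynamics
    (hdyn : ∀ t, x (t + 1) = toEuclideanLin (A t) (x t)
      + toEuclideanLin (B t) (toEuclideanLin (K (t / T)) (x t) + v t))
    -- (ii) uniform bounds
    (hv : ∀ t, ‖v t‖ ≤ vbar) (hB : ∀ t, ‖B t‖ ≤ Bbar)
    -- (iii) Lyapunov decrease on each interval
    (hLyap : ∀ i t, i * T ≤ t → t < (i + 1) * T →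
      (lam • P i - (A t + B t * K i)ᵀ * P i * (A t + B t * K i)).PosSemidef)
    -- (iv) sandwich condition
    (hsand₁ : ∀ i, (P i - σ₁ • (1 : Matrix (Fin n) (Fin n) ℝ)).PosSemidef)
    (hsand₂ : ∀ i, (σ₂ • (1 : Matrix (Fin n) (Fin n) ℝ) - P i).PosSemidef)
    -- (v) condition at gain updates
    (hswitch : ∀ i, (((lamhat / lam) ^ T) • P i - P (i + 1)).PosSemidef) :
    ∀ t : ℕ,
      ‖x t‖ ≤ Real.sqrt (σ₂ / σ₁) * lamhat ^ ((t : ℝ) / 2) * ‖x 0‖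
        + Real.sqrt (σ₂ / σ₁) * (1 - Real.sqrt lamhat)⁻¹
          * (lamhat / lam) ^ ((T : ℝ) / 2) * Bbar * vbar := by
  have hPpsd : ∀ i, (P i).PosSemidef := by
    intro i
    have h := (hsand₁ i).add (Matrix.PosSemidef.one.smul hσ₁.le)
    simpa using h
  have hC : ∀ i, ∃ C : Matrix (Fin n) (Fin n) ℝ, P i = Cᴴ * C := by
    intro i
    open scoped MatrixOrder in
    exact CStarAlgebra.nonneg_iff_eq_star_mul_self.mp (hPpsd i).nonneg
  choose C hC using hC
  set q : ℕ → EuclideanSpace ℝ (Fin n) → ℝ := fun i y => ‖toEuclideanLin (C i) y‖ with hq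
  have hq0 : ∀ i y, 0 ≤ q i y := fun i y => norm_nonneg _
  have hqsq : ∀ i y, q i y ^ 2 = y.ofLp ⬝ᵥ (P i *ᵥ y.ofLp) := by
    intro i y
    rw [hq, hC i]
    exact aux_norm_sq _ _
  have hqadd : ∀ i y z, q i (y + z) ≤ q i y + q i z := by
    intro i y z
    simp only [hq, map_add]
    exact norm_add_le _ _
  have hlow : ∀ i y, √σ₁ * ‖y‖ ≤ q i y := by
    intro i y
    have h := aux_quad_nonneg (hsand₁ i) y.ofLp
    rw [Matrix.sub_mulVec, dotProduct_sub, ← hqsq, Matrix.smul_mulVec, Matrix.one_mulVec,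
      dotProduct_smul, ← aux_norm_sq', smul_eq_mul] at h
    refine le_trans (le_abs_self _) (abs_le_of_sq_le_sq ?_ (hq0 i y))
    rw [mul_pow, Real.sq_sqrt hσ₁.le]
    linarith
  have hup : ∀ i y, q i y ≤ √σ₂ * ‖y‖ := by
    intro i y
    have h := aux_quad_nonneg (hsand₂ i) y.ofLp
    rw [Matrix.sub_mulVec, dotProduct_sub, ← hqsq, Matrix.smul_mulVec, Matrix.one_mulVec,
      dotProduct_smul, ← aux_norm_sq', smul_eq_mul] at h
    exact aux_sq_sqrt (norm_nonneg _) hσ₂.le (by linarith)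
  set ρ := lamhat / lam with hρ
  have hρ1 : 1 ≤ ρ := by rw [hρ, le_div_iff₀ hlam0]; linarith
  have hρ0 : 0 ≤ ρ := by linarith
  have hlh0 : 0 < lamhat := by linarith
  have hsw : ∀ i y, q (i + 1) y ≤ √ρ ^ T * q i y := by
    intro i y
    have h := aux_quad_nonneg (hswitch i) y.ofLp
    rw [Matrix.sub_mulVec, dotProduct_sub, ← hqsq, Matrix.smul_mulVec,
      dotProduct_smul, ← hqsq, smul_eq_mul] at h
    have := aux_sq_sqrt (a := q (i + 1) y) (hq0 i y) (pow_nonneg hρ0 T) (by linarith)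
    have e : √(ρ ^ T) = √ρ ^ T := by
      rw [Real.sqrt_eq_iff_mul_self_eq (by positivity) (by positivity), ← mul_pow,
        Real.mul_self_sqrt hρ0]
    rwa [e] at this
  have hd : ∀ t, ‖toEuclideanLin (B t) (v t)‖ ≤ Bbar * vbar := by
    intro t
    calc ‖toEuclideanLin (B t) (v t)‖ ≤ ‖B t‖ * ‖v t‖ := Matrix.l2_opNorm_mulVec (B t) (v t)
      _ ≤ Bbar * vbar := by
        gcongr
        · exact hB t
        · exact hv t
  have hstep : ∀ t, q (t / T) (x (t + 1)) ≤ √lam * q (t / T) (x t) + √σ₂ * (Bbar * vbar) := by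
    intro t
    have hx : x (t + 1) = toEuclideanLin (A t + B t * K (t / T)) (x t)
        + toEuclideanLin (B t) (v t) := by
      rw [hdyn t]
      ext j
      simp [Matrix.toLpLin_apply, Matrix.add_mulVec, Matrix.mulVec_add, Matrix.mulVec_mulVec]
      try ring
    have h1 : q (t / T) (toEuclideanLin (A t + B t * K (t / T)) (x t))
        ≤ √lam * q (t / T) (x t) := by
      apply aux_sq_sqrt (hq0 _ _) hlam0.le
      have h := aux_quad_nonneg (hLyap (t / T) t (Nat.div_mul_le_self t T)
        (by rw [mul_comm]; exact Nat.lt_mul_div_succ t hT)) (x t).ofLp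
      rw [Matrix.sub_mulVec, dotProduct_sub, Matrix.smul_mulVec,
        dotProduct_smul, ← hqsq, smul_eq_mul] at h
      rw [hqsq (t / T) (toEuclideanLin _ _)]
      have e : ∀ M : Matrix (Fin n) (Fin n) ℝ, (x t).ofLp ⬝ᵥ ((Mᵀ * P (t / T) * M) *ᵥ (x t).ofLp)
          = (toEuclideanLin M (x t)).ofLp ⬝ᵥ
            (P (t / T) *ᵥ (toEuclideanLin M (x t)).ofLp) := by
        intro M
        rw [← Matrix.mulVec_mulVec, ← Matrix.mulVec_mulVec, Matrix.dotProduct_mulVec,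
          Matrix.vecMul_transpose]
        rfl
      rw [e] at h
      linarith
    rw [hx]
    refine (hqadd _ _ _).trans (add_le_add h1 ((hup _ _).trans ?_))
    gcongr
    exact hd t
  have hs1 : 1 ≤ √ρ := by rw [Real.one_le_sqrt]; exact hρ1
  have hlh : √ρ * √lam = √lamhat := by
    rw [← Real.sqrt_mul hρ0, hρ, div_mul_cancel₀ _ hlam0.ne']
  have hD : 0 ≤ √σ₂ * (Bbar * vbar) := by positivity
  have hW : ∀ t, √ρ ^ ((t + 1) % T) * q ((t + 1) / T) (x (t + 1))
      ≤ √lamhat * (√ρ ^ (t % T) * q (t / T) (x t)) + √ρ ^ T * (√σ₂ * (Bbar * vbar)) := by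
    intro t
    have hlt := Nat.mod_lt t hT
    have key : √ρ ^ (t % T + 1) * q (t / T) (x (t + 1))
        ≤ √lamhat * (√ρ ^ (t % T) * q (t / T) (x t)) + √ρ ^ T * (√σ₂ * (Bbar * vbar)) := by
      calc √ρ ^ (t % T + 1) * q (t / T) (x (t + 1))
          ≤ √ρ ^ (t % T + 1) * (√lam * q (t / T) (x t) + √σ₂ * (Bbar * vbar)) := by
            gcongr
            exact hstep t
        _ = √lamhat * (√ρ ^ (t % T) * q (t / T) (x t))
            + √ρ ^ (t % T + 1) * (√σ₂ * (Bbar * vbar)) := by rw [← hlh]; ring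
        _ ≤ _ := by
            gcongr
            omega
    have hdm := Nat.div_add_mod t T
    by_cases hc : t % T + 1 < T
    · have e : t + 1 = (t % T + 1) + T * (t / T) := by omega
      have e1 : (t + 1) % T = t % T + 1 := by
        rw [e, Nat.add_mul_mod_self_left, Nat.mod_eq_of_lt hc]
      have e2 : (t + 1) / T = t / T := by
        conv_lhs => rw [e, Nat.add_mul_div_left _ _ hT, Nat.div_eq_of_lt hc, zero_add]
      rw [e1, e2]
      exact key
    · have hc' : t % T + 1 = T := by omega
      have e : t + 1 = T * (t / T + 1) := by rw [mul_add]; omega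
      have e1 : (t + 1) % T = 0 := by rw [e, Nat.mul_mod_right]
      have e2 : (t + 1) / T = t / T + 1 := by
        conv_lhs => rw [e, Nat.mul_div_cancel_left _ hT]
      rw [e1, e2, pow_zero, one_mul]
      rw [hc'] at key
      exact (hsw _ _).trans key
  have hr1 : √lamhat < 1 := by
    rw [Real.sqrt_lt' one_pos]; linarith
  have hsqrtpow : ∀ (a : ℝ) (k : ℕ), 0 ≤ a → a ^ ((k : ℝ) / 2) = √a ^ k := by
    intro a k ha
    rw [Real.sqrt_eq_rpow, ← Real.rpow_natCast, ← Real.rpow_mul ha]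
    congr 1
    ring
  intro t
  have hfin := aux_rec (fun t => √ρ ^ (t % T) * q (t / T) (x t)) √lamhat
    (√ρ ^ T * (√σ₂ * (Bbar * vbar))) (Real.sqrt_nonneg _) hr1 (by positivity) hW t
  simp only [Nat.zero_mod, Nat.zero_div, pow_zero, one_mul] at hfin
  have h1 : √σ₁ * ‖x t‖ ≤ √lamhat ^ t * (√σ₂ * ‖x 0‖)
      + (1 - √lamhat)⁻¹ * (√ρ ^ T * (√σ₂ * (Bbar * vbar))) := by
    calc √σ₁ * ‖x t‖ ≤ q (t / T) (x t) := hlow _ _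
      _ ≤ √ρ ^ (t % T) * q (t / T) (x t) :=
        le_mul_of_one_le_left (hq0 _ _) (one_le_pow₀ hs1)
      _ ≤ _ := hfin
      _ ≤ _ := by
        gcongr
        exact hup _ _
  have hs : 0 < √σ₁ := Real.sqrt_pos.mpr hσ₁
  rw [hsqrtpow _ _ hlh0.le, hsqrtpow _ _ hρ0, Real.sqrt_div' _ hσ₁.le]
  rw [mul_comm, ← le_div_iff₀ hs] at h1
  refine h1.trans (le_of_eq ?_)
  ring
end

section
/- Fix λ ∈ (0,1). Suppose there exist scalars α₁ ≥ 0, α₂ ≥ 0, a positive definite matrix Q ∈ ℝ^{n×n} and a matrix L₀ ∈ ℝ^{m×n} such that M̄ − α₁ N̄₁ − α₂ N̄₂ ⪰ 0. Then, setting K := L₀ Q⁻¹ and P := Q⁻¹, for every (A₀, B₀) ∈ Σ and every (ΔA, ΔB) ∈ Σ^D, the matrices A := A₀ + ΔA and B := B₀ + ΔB satisfy (A + B K)ᵀ P (A + B K) ⪯ λ P. -/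
open Matrix

/-- The block column `C = [0; Q; L₀; Q; L₀]` (block sizes n, n, m, n, m). -/
noncomputable def Cblk {n m : ℕ} (Q : Matrix (Fin n) (Fin n) ℝ) (L₀ : Matrix (Fin m) (Fin n) ℝ) :
    Matrix (Fin n ⊕ (Fin n ⊕ (Fin m ⊕ (Fin n ⊕ Fin m)))) (Fin n) ℝ :=
  fromRows 0 (fromRows Q (fromRows L₀ (fromRows Q L₀)))

/-- `M̄`: all blocks zero except `M̄₁₁ = λQ`, `M̄₂₆ = Q`, `M̄₃₆ = L₀`, `M̄₄₆ = Q`,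
`M̄₅₆ = L₀`, `M̄₆₆ = Q` (and symmetric counterparts). Block sizes (n,n,m,n,m,n). -/
noncomputable def Mbar {n m : ℕ} (lam : ℝ) (Q : Matrix (Fin n) (Fin n) ℝ)
    (L₀ : Matrix (Fin m) (Fin n) ℝ) :
    Matrix ((Fin n ⊕ (Fin n ⊕ (Fin m ⊕ (Fin n ⊕ Fin m)))) ⊕ Fin n)
      ((Fin n ⊕ (Fin n ⊕ (Fin m ⊕ (Fin n ⊕ Fin m)))) ⊕ Fin n) ℝ :=
  fromBlocks (fromBlocks (lam • Q) 0 0 0) (Cblk Q L₀) (Cblk Q L₀)ᵀ Q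

/-- `R̄₁` with block rows `(I,X⁺), (0,−X), (0,−U), (0,0), (0,0), (0,0)`. -/
noncomputable def R1bar {n m N : ℕ} (X Xp : Matrix (Fin n) (Fin N) ℝ)
    (U : Matrix (Fin m) (Fin N) ℝ) :
    Matrix ((Fin n ⊕ (Fin n ⊕ (Fin m ⊕ (Fin n ⊕ Fin m)))) ⊕ Fin n) (Fin n ⊕ Fin N) ℝ :=
  fromRows
    (fromRows (fromCols 1 Xp)
      (fromRows (fromCols 0 (-X)) (fromRows (fromCols 0 (-U)) 0)))
    0

/-- `N̄₁ = R̄₁ · blkdiag(Π, −I_N) · R̄₁ᵀ` with `Π = π I_n`. -/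
noncomputable def N1bar {n m N : ℕ} (X Xp : Matrix (Fin n) (Fin N) ℝ)
    (U : Matrix (Fin m) (Fin N) ℝ) (pi : ℝ) :
    Matrix ((Fin n ⊕ (Fin n ⊕ (Fin m ⊕ (Fin n ⊕ Fin m)))) ⊕ Fin n)
      ((Fin n ⊕ (Fin n ⊕ (Fin m ⊕ (Fin n ⊕ Fin m)))) ⊕ Fin n) ℝ :=
  R1bar X Xp U * fromBlocks (pi • (1 : Matrix (Fin n) (Fin n) ℝ)) 0 0 (-1 : Matrix (Fin N) (Fin N) ℝ)
    * (R1bar X Xp U)ᵀ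

/-- `R̄₂` with block rows `(I,0,0), (0,0,0), (0,0,0), (0,I,0), (0,0,I), (0,0,0)`. -/
noncomputable def R2bar (n m : ℕ) :
    Matrix ((Fin n ⊕ (Fin n ⊕ (Fin m ⊕ (Fin n ⊕ Fin m)))) ⊕ Fin n)
      (Fin n ⊕ (Fin n ⊕ Fin m)) ℝ :=
  fromRows
    (fromRows (fromCols 1 0)
      (fromRows 0 (fromRows 0
        (fromRows (fromCols 0 (fromCols 1 0)) (fromCols 0 (fromCols 0 1))))))
    0

/-- `N̄₂ = R̄₂ · blkdiag(L²T² I_n, −I_n, −I_m) · R̄₂ᵀ`. -/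
noncomputable def N2bar (n m : ℕ) (L : ℝ) (T : ℕ) :
    Matrix ((Fin n ⊕ (Fin n ⊕ (Fin m ⊕ (Fin n ⊕ Fin m)))) ⊕ Fin n)
      ((Fin n ⊕ (Fin n ⊕ (Fin m ⊕ (Fin n ⊕ Fin m)))) ⊕ Fin n) ℝ :=
  R2bar n m * fromBlocks ((L ^ 2 * (T : ℝ) ^ 2) • (1 : Matrix (Fin n) (Fin n) ℝ)) 0 0
      (fromBlocks (-1 : Matrix (Fin n) (Fin n) ℝ) 0 0 (-1 : Matrix (Fin m) (Fin m) ℝ)) * (R2bar n m)ᵀ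

/-- Membership in the data-consistency set `Σ`. -/
def memSigma {n m N : ℕ} (X Xp : Matrix (Fin n) (Fin N) ℝ) (U : Matrix (Fin m) (Fin N) ℝ)
    (pi : ℝ) (A₀ : Matrix (Fin n) (Fin n) ℝ) (B₀ : Matrix (Fin n) (Fin m) ℝ) : Prop :=
  ∃ W : Matrix (Fin n) (Fin N) ℝ, Xp = A₀ * X + B₀ * U + W ∧
    (pi • (1 : Matrix (Fin n) (Fin n) ℝ) - W * Wᵀ).PosSemidef

/-- Membership in the perturbation set `Σ^D`. -/
def memSigmaD {n m : ℕ} (L : ℝ) (T : ℕ) (ΔA : Matrix (Fin n) (Fin n) ℝ)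
    (ΔB : Matrix (Fin n) (Fin m) ℝ) : Prop :=
  ((L ^ 2 * (T : ℝ) ^ 2) • (1 : Matrix (Fin n) (Fin n) ℝ)
    - (ΔA * ΔAᵀ + ΔB * ΔBᵀ)).PosSemidef

/-- The block column used for the congruence. -/
noncomputable def Vcol {n m : ℕ} (A D : Matrix (Fin n) (Fin n) ℝ) (B E : Matrix (Fin n) (Fin m) ℝ)
    (Y Z : Matrix (Fin n) (Fin n) ℝ) :
    Matrix ((Fin n ⊕ (Fin n ⊕ (Fin m ⊕ (Fin n ⊕ Fin m)))) ⊕ Fin n) (Fin n) ℝ :=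
  fromRows (fromRows Y (fromRows (Aᵀ * Y) (fromRows (Bᵀ * Y) (fromRows (Dᵀ * Y) (Eᵀ * Y))))) Z

theorem Vcol_M {n m : ℕ} (A D : Matrix (Fin n) (Fin n) ℝ) (B E : Matrix (Fin n) (Fin m) ℝ)
    (Y Z Q : Matrix (Fin n) (Fin n) ℝ) (L₀ : Matrix (Fin m) (Fin n) ℝ) (lam : ℝ) :
    (Vcol A D B E Y Z)ᵀ * Mbar lam Q L₀ * Vcol A D B E Y Z =
      lam • (Yᵀ * Q * Y) + Yᵀ * ((A + D) * Q + (B + E) * L₀) * Z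
        + Zᵀ * ((A + D) * Q + (B + E) * L₀)ᵀ * Y + Zᵀ * Q * Z := by
  have hC : (fromRows Y (fromRows (Aᵀ * Y) (fromRows (Bᵀ * Y) (fromRows (Dᵀ * Y) (Eᵀ * Y)))))ᵀ
      * Cblk Q L₀ = Yᵀ * ((A + D) * Q + (B + E) * L₀) := by
    simp only [Cblk, transpose_fromRows, fromCols_mul_fromRows, transpose_mul,
      transpose_transpose, Matrix.mul_zero, Matrix.mul_add, Matrix.add_mul, Matrix.mul_assoc,
      zero_add]
    abel
  have hC' : (Cblk Q L₀)ᵀ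
      * (fromRows Y (fromRows (Aᵀ * Y) (fromRows (Bᵀ * Y) (fromRows (Dᵀ * Y) (Eᵀ * Y)))))
      = ((A + D) * Q + (B + E) * L₀)ᵀ * Y := by
    have := congrArg transpose hC
    rwa [transpose_mul, transpose_transpose, transpose_mul, transpose_transpose] at this
  have h11 : (fromRows Y (fromRows (Aᵀ * Y) (fromRows (Bᵀ * Y) (fromRows (Dᵀ * Y) (Eᵀ * Y)))))ᵀ
      * (fromBlocks (lam • Q) 0 0 0 : Matrix (Fin n ⊕ (Fin n ⊕ (Fin m ⊕ (Fin n ⊕ Fin m))))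
          (Fin n ⊕ (Fin n ⊕ (Fin m ⊕ (Fin n ⊕ Fin m)))) ℝ)
      * (fromRows Y (fromRows (Aᵀ * Y) (fromRows (Bᵀ * Y) (fromRows (Dᵀ * Y) (Eᵀ * Y)))))
      = lam • (Yᵀ * Q * Y) := by
    rw [transpose_fromRows, fromCols_mul_fromBlocks, fromCols_mul_fromRows]
    simp only [Matrix.mul_zero, Matrix.zero_mul, add_zero, Matrix.mul_smul, Matrix.smul_mul]
  unfold Vcol Mbar
  generalize fromRows Y (fromRows (Aᵀ * Y) (fromRows (Bᵀ * Y) (fromRows (Dᵀ * Y) (Eᵀ * Y)))) = P at *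
  rw [transpose_fromRows, fromCols_mul_fromBlocks, fromCols_mul_fromRows, Matrix.add_mul,
    Matrix.add_mul, h11, hC, Matrix.mul_assoc Zᵀ, hC', ← Matrix.mul_assoc Zᵀ]
  abel

theorem Vcol_N1 {n m N : ℕ} (A D : Matrix (Fin n) (Fin n) ℝ) (B E : Matrix (Fin n) (Fin m) ℝ)
    (Y Z : Matrix (Fin n) (Fin n) ℝ) (X Xp W : Matrix (Fin n) (Fin N) ℝ)
    (U : Matrix (Fin m) (Fin N) ℝ) (pi : ℝ) (h : Xp = A * X + B * U + W) :
    (Vcol A D B E Y Z)ᵀ * N1bar X Xp U pi * Vcol A D B E Y Z =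
      Yᵀ * (pi • (1 : Matrix (Fin n) (Fin n) ℝ) - W * Wᵀ) * Y := by
  have h1 : (R1bar X Xp U)ᵀ * Vcol A D B E Y Z = fromRows Y (Wᵀ * Y) := by
    subst h
    simp [Vcol, R1bar, transpose_fromRows, transpose_fromCols, fromCols_mul_fromRows, fromRows_mul,
      Matrix.add_mul, Matrix.mul_assoc]
    ext (i | i) j <;> simp
    abel
  have h2 : (Vcol A D B E Y Z)ᵀ * R1bar X Xp U = (fromRows Y (Wᵀ * Y))ᵀ := by
    rw [← h1, transpose_mul, transpose_transpose]
  calc _ = ((Vcol A D B E Y Z)ᵀ * R1bar X Xp U) * fromBlocks (pi • (1 : Matrix (Fin n) (Fin n) ℝ)) 0 0 (-1 : Matrix (Fin N) (Fin N) ℝ) * ((R1bar X Xp U)ᵀ * Vcol A D B E Y Z) := by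
        simp only [N1bar, Matrix.mul_assoc]
    _ = _ := by
        rw [h1, h2]
        simp [transpose_fromRows, fromCols_mul_fromRows, fromCols_mul_fromBlocks,
          Matrix.mul_add, Matrix.add_mul, Matrix.mul_assoc, sub_eq_add_neg]

theorem Vcol_N2 {n m : ℕ} (A D : Matrix (Fin n) (Fin n) ℝ) (B E : Matrix (Fin n) (Fin m) ℝ)
    (Y Z : Matrix (Fin n) (Fin n) ℝ) (L : ℝ) (T : ℕ) :
    (Vcol A D B E Y Z)ᵀ * N2bar n m L T * Vcol A D B E Y Z =
      Yᵀ * ((L ^ 2 * (T : ℝ) ^ 2) • (1 : Matrix (Fin n) (Fin n) ℝ) - (D * Dᵀ + E * Eᵀ)) * Y := by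
  have h1 : (R2bar n m)ᵀ * Vcol A D B E Y Z = fromRows Y (fromRows (Dᵀ * Y) (Eᵀ * Y)) := by
    simp only [Vcol, R2bar, transpose_fromRows, transpose_fromCols, fromCols_mul_fromRows,
      fromRows_mul, transpose_zero, Matrix.zero_mul, transpose_one, Matrix.one_mul]
    ext (i | i | i) j <;> simp
  have h2 : (Vcol A D B E Y Z)ᵀ * R2bar n m = (fromRows Y (fromRows (Dᵀ * Y) (Eᵀ * Y)))ᵀ := by
    rw [← h1, transpose_mul, transpose_transpose]
  calc _ = ((Vcol A D B E Y Z)ᵀ * R2bar n m) * fromBlocks ((L ^ 2 * (T : ℝ) ^ 2) • (1 : Matrix (Fin n) (Fin n) ℝ)) 0 0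
          (fromBlocks (-1 : Matrix (Fin n) (Fin n) ℝ) 0 0 (-1 : Matrix (Fin m) (Fin m) ℝ)) * ((R2bar n m)ᵀ * Vcol A D B E Y Z) := by
        simp only [N2bar, Matrix.mul_assoc]
    _ = _ := by
        rw [h1, h2]
        simp [transpose_fromRows, fromCols_mul_fromRows, fromCols_mul_fromBlocks,
          Matrix.mul_sub, Matrix.sub_mul, Matrix.mul_add, Matrix.add_mul, Matrix.mul_assoc, sub_eq_add_neg]
        try abel

/-- Proposition 1: an LMI for the feedback gain. -/
theorem prop1_LMI (n m N : ℕ) (hn : 0 < n) (hm : 0 < m) (hN : 0 < N)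
    (X Xp : Matrix (Fin n) (Fin N) ℝ) (U : Matrix (Fin m) (Fin N) ℝ)
    (pi : ℝ) (hpi : 0 ≤ pi) (L : ℝ) (hL : 0 ≤ L) (T : ℕ) (hT : 0 < T)
    (lam : ℝ) (hlam0 : 0 < lam) (hlam1 : lam < 1)
    (α₁ α₂ : ℝ) (hα₁ : 0 ≤ α₁) (hα₂ : 0 ≤ α₂)
    (Q : Matrix (Fin n) (Fin n) ℝ) (hQ : Q.PosDef)
    (L₀ : Matrix (Fin m) (Fin n) ℝ)
    (hLMI : (Mbar lam Q L₀ - α₁ • N1bar X Xp U pi - α₂ • N2bar n m L T).PosSemidef)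
    (A₀ ΔA : Matrix (Fin n) (Fin n) ℝ) (B₀ ΔB : Matrix (Fin n) (Fin m) ℝ)
    (hA : memSigma X Xp U pi A₀ B₀) (hD : memSigmaD L T ΔA ΔB) :
    (lam • Q⁻¹ - (A₀ + ΔA + (B₀ + ΔB) * (L₀ * Q⁻¹))ᵀ * Q⁻¹
      * (A₀ + ΔA + (B₀ + ΔB) * (L₀ * Q⁻¹))).PosSemidef := by
  obtain ⟨W, hW, hWp⟩ := hA
  have hdet : IsUnit Q.det := hQ.det_pos.ne'.isUnit
  have hQt : Qᵀ = Q := by simpa using hQ.isHermitian.eq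
  have hQit : (Q⁻¹)ᵀ = Q⁻¹ := by rw [transpose_nonsing_inv, hQt]
  set F := A₀ + ΔA + (B₀ + ΔB) * (L₀ * Q⁻¹) with hF
  have hFQ : (A₀ + ΔA) * Q + (B₀ + ΔB) * L₀ = F * Q := by
    rw [hF, Matrix.add_mul (A₀ + ΔA) ((B₀ + ΔB) * (L₀ * Q⁻¹)) Q, Matrix.mul_assoc, Matrix.mul_assoc,
      nonsing_inv_mul Q hdet, Matrix.mul_one]
  set Y : Matrix (Fin n) (Fin n) ℝ := -(Q⁻¹ * F) with hY
  set V := Vcol A₀ ΔA B₀ ΔB Y (lam • Q⁻¹) with hV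
  have k := hLMI.conjTranspose_mul_mul_same V
  have k1 := (hWp.conjTranspose_mul_mul_same Y).smul hα₁
  have k2 := (PosSemidef.conjTranspose_mul_mul_same (show PosSemidef _ from hD) Y).smul hα₂
  have key := ((k.add k1).add k2).smul (inv_nonneg.mpr hlam0.le)
  convert key using 1
  simp only [conjTranspose_eq_transpose_of_trivial]
  rw [Matrix.mul_sub, Matrix.mul_sub, Matrix.sub_mul, Matrix.sub_mul, Matrix.mul_smul,
    Matrix.mul_smul, Matrix.smul_mul, Matrix.smul_mul, hV, Vcol_N1 _ _ _ _ _ _ _ _ _ _ _ hW,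
    Vcol_N2, Vcol_M, hFQ]
  have e1 : Yᵀ * Q * Y = Fᵀ * Q⁻¹ * F := by
    simp only [hY, transpose_neg, transpose_mul, hQit, Matrix.neg_mul, Matrix.mul_neg, neg_neg,
      Matrix.mul_assoc]
    rw [mul_nonsing_inv_cancel_left _ _ hdet]
  have e2 : Yᵀ * (F * Q) * (lam • Q⁻¹) = -(lam • (Fᵀ * Q⁻¹ * F)) := by
    simp only [hY, transpose_neg, transpose_mul, hQit, Matrix.neg_mul, Matrix.mul_smul,
      Matrix.mul_assoc, mul_nonsing_inv Q hdet, Matrix.mul_one, smul_neg]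
  have e3 : (lam • Q⁻¹)ᵀ * (F * Q)ᵀ * Y = -(lam • (Fᵀ * Q⁻¹ * F)) := by
    simp only [hY, transpose_smul, transpose_mul, hQit, hQt, Matrix.smul_mul, Matrix.mul_neg,
      Matrix.mul_assoc, smul_neg]
    rw [nonsing_inv_mul_cancel_left _ _ hdet]
  have e4 : (lam • Q⁻¹)ᵀ * Q * (lam • Q⁻¹) = lam • lam • Q⁻¹ := by
    simp only [transpose_smul, hQit, Matrix.smul_mul, Matrix.mul_smul, nonsing_inv_mul Q hdet,
      Matrix.one_mul]
  rw [e1, e2, e3, e4]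
  have e5 : lam • (lam • Q⁻¹ - Fᵀ * Q⁻¹ * F) = lam • lam • Q⁻¹ - lam • (Fᵀ * Q⁻¹ * F) := smul_sub _ _ _
  rw [eq_inv_smul_iff₀ hlam0.ne', e5]
  abel
end

section
/- Fix λ ∈ (0,1). Suppose there exist scalars α₁ ≥ 0, α₂ ≥ 0, a positive definite matrix Q ∈ ℝ^{n×n} and a matrix L₀ ∈ ℝ^{m×n} such that M − α₁ N₁ − α₂ N₂ ⪰ 0. Then, setting K := L₀ Q⁻¹ and P := Q⁻¹, for every (A₀, B₀) ∈ Σ and every (ΔA, ΔB) ∈ Σ^D, the matrices A := A₀ + ΔA and B := B₀ + ΔB satisfy (A + B K)ᵀ P (A + B K) ⪯ λ P. -/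
open Matrix

/-- `M = blkdiag(λQ,0,0,0,0) − C Q⁻¹ Cᵀ`. -/
noncomputable def Mmat {n m : ℕ} (lam : ℝ) (Q : Matrix (Fin n) (Fin n) ℝ)
    (L₀ : Matrix (Fin m) (Fin n) ℝ) :
    Matrix (Fin n ⊕ (Fin n ⊕ (Fin m ⊕ (Fin n ⊕ Fin m))))
      (Fin n ⊕ (Fin n ⊕ (Fin m ⊕ (Fin n ⊕ Fin m)))) ℝ :=
  fromBlocks (lam • Q) 0 0 0 - Cblk Q L₀ * Q⁻¹ * (Cblk Q L₀)ᵀ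

/-- `R₁` with block rows `(I,X⁺), (0,−X), (0,−U), (0,0), (0,0)`. -/
noncomputable def R1 {n m N : ℕ} (X Xp : Matrix (Fin n) (Fin N) ℝ)
    (U : Matrix (Fin m) (Fin N) ℝ) :
    Matrix (Fin n ⊕ (Fin n ⊕ (Fin m ⊕ (Fin n ⊕ Fin m)))) (Fin n ⊕ Fin N) ℝ :=
  fromRows (fromCols 1 Xp)
    (fromRows (fromCols 0 (-X)) (fromRows (fromCols 0 (-U)) 0))

/-- `N₁ = R₁ · blkdiag(Π, −I_N) · R₁ᵀ` with `Π = π I_n`. -/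
noncomputable def N1 {n m N : ℕ} (X Xp : Matrix (Fin n) (Fin N) ℝ)
    (U : Matrix (Fin m) (Fin N) ℝ) (pi : ℝ) :
    Matrix (Fin n ⊕ (Fin n ⊕ (Fin m ⊕ (Fin n ⊕ Fin m))))
      (Fin n ⊕ (Fin n ⊕ (Fin m ⊕ (Fin n ⊕ Fin m)))) ℝ :=
  R1 X Xp U * fromBlocks (pi • (1 : Matrix (Fin n) (Fin n) ℝ)) 0 0
      (-1 : Matrix (Fin N) (Fin N) ℝ) * (R1 X Xp U)ᵀ

/-- `R₂` with block rows `(I,0,0), (0,0,0), (0,0,0), (0,I,0), (0,0,I)`. -/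
noncomputable def R2 (n m : ℕ) :
    Matrix (Fin n ⊕ (Fin n ⊕ (Fin m ⊕ (Fin n ⊕ Fin m)))) (Fin n ⊕ (Fin n ⊕ Fin m)) ℝ :=
  fromRows (fromCols 1 0)
    (fromRows 0 (fromRows 0
      (fromRows (fromCols 0 (fromCols 1 0)) (fromCols 0 (fromCols 0 1)))))

/-- `N₂ = R₂ · blkdiag(L²T² I_n, −I_n, −I_m) · R₂ᵀ`. -/
noncomputable def N2 (n m : ℕ) (L : ℝ) (T : ℕ) :
    Matrix (Fin n ⊕ (Fin n ⊕ (Fin m ⊕ (Fin n ⊕ Fin m))))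
      (Fin n ⊕ (Fin n ⊕ (Fin m ⊕ (Fin n ⊕ Fin m)))) ℝ :=
  R2 n m * fromBlocks ((L ^ 2 * (T : ℝ) ^ 2) • (1 : Matrix (Fin n) (Fin n) ℝ)) 0 0
      (fromBlocks (-1 : Matrix (Fin n) (Fin n) ℝ) 0 0 (-1 : Matrix (Fin m) (Fin m) ℝ)) * (R2 n m)ᵀ

theorem my_fc_add {a b c : Type*} (A A' : Matrix a b ℝ) (B B' : Matrix a c ℝ) :
    fromCols A B + fromCols A' B' = fromCols (A + A') (B + B') := by
  ext i (j | j) <;> simp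

/-- Proposition 1 in its reduced form (28). -/
theorem prop1_reduced (n m N : ℕ) (hn : 0 < n) (hm : 0 < m) (hN : 0 < N)
    (X Xp : Matrix (Fin n) (Fin N) ℝ) (U : Matrix (Fin m) (Fin N) ℝ)
    (pi : ℝ) (hpi : 0 ≤ pi) (L : ℝ) (hL : 0 ≤ L) (T : ℕ) (hT : 0 < T)
    (lam : ℝ) (hlam0 : 0 < lam) (hlam1 : lam < 1)
    (α₁ α₂ : ℝ) (hα₁ : 0 ≤ α₁) (hα₂ : 0 ≤ α₂)
    (Q : Matrix (Fin n) (Fin n) ℝ) (hQ : Q.PosDef)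
    (L₀ : Matrix (Fin m) (Fin n) ℝ)
    (hLMI : (Mmat lam Q L₀ - α₁ • N1 X Xp U pi - α₂ • N2 n m L T).PosSemidef)
    (A₀ ΔA : Matrix (Fin n) (Fin n) ℝ) (B₀ ΔB : Matrix (Fin n) (Fin m) ℝ)
    (hA : memSigma X Xp U pi A₀ B₀) (hD : memSigmaD L T ΔA ΔB) :
    (lam • Q⁻¹ - (A₀ + ΔA + (B₀ + ΔB) * (L₀ * Q⁻¹))ᵀ * Q⁻¹
      * (A₀ + ΔA + (B₀ + ΔB) * (L₀ * Q⁻¹))).PosSemidef := by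
  obtain ⟨W, hX, hW⟩ := hA
  unfold memSigmaD at hD
  have hdet : IsUnit Q.det := (Matrix.isUnit_iff_isUnit_det Q).1 hQ.isUnit
  have hQt : Qᵀ = Q := by
    have := hQ.1
    rwa [Matrix.IsHermitian, conjTranspose_eq_transpose_of_trivial] at this
  have hQit : Q⁻¹ᵀ = Q⁻¹ := by rw [transpose_nonsing_inv, hQt]
  set Z : Matrix (Fin n) (Fin n ⊕ (Fin n ⊕ (Fin m ⊕ (Fin n ⊕ Fin m)))) ℝ :=
    fromCols 1 (fromCols A₀ (fromCols B₀ (fromCols ΔA ΔB))) with hZ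
  set F := A₀ + ΔA + (B₀ + ΔB) * (L₀ * Q⁻¹) with hF
  have hZC : Z * Cblk Q L₀ = F * Q := by
    have h1 : L₀ * Q⁻¹ * Q = L₀ := by rw [Matrix.mul_assoc, nonsing_inv_mul Q hdet, Matrix.mul_one]
    simp only [hZ, Cblk, fromCols_mul_fromRows, hF, Matrix.add_mul, Matrix.mul_assoc]
    simp only [nonsing_inv_mul Q hdet, Matrix.mul_one, Matrix.mul_zero]
    abel
  have hZM : Z * Mmat lam Q L₀ * Zᵀ = lam • Q - F * Q * Fᵀ := by
    have e : Z * Mmat lam Q L₀ * Zᵀ = Z * (fromBlocks (lam • Q) 0 0 0 : Matrix (Fin n ⊕ (Fin n ⊕ (Fin m ⊕ (Fin n ⊕ Fin m))))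
          (Fin n ⊕ (Fin n ⊕ (Fin m ⊕ (Fin n ⊕ Fin m)))) ℝ) * Zᵀ
        - (Z * Cblk Q L₀) * Q⁻¹ * (Z * Cblk Q L₀)ᵀ := by
      simp only [Mmat, Matrix.mul_sub, Matrix.sub_mul, transpose_mul, Matrix.mul_assoc]
    rw [e, hZC]
    congr 1
    · simp only [hZ, fromCols_mul_fromBlocks, transpose_fromCols, fromCols_mul_fromRows]
      simp
    · rw [Matrix.mul_assoc F Q, mul_nonsing_inv Q hdet, Matrix.mul_one, transpose_mul, hQt,
        ← Matrix.mul_assoc]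
  have hZR1 : Z * R1 X Xp U = fromCols 1 W := by
    simp only [hZ, R1, fromCols_mul_fromRows, mul_fromCols, Matrix.mul_zero, Matrix.one_mul,
      Matrix.mul_neg, my_fc_add, add_zero]
    rw [hX]
    congr 1
    abel
  have hZN1 : Z * N1 X Xp U pi * Zᵀ = pi • (1 : Matrix (Fin n) (Fin n) ℝ) - W * Wᵀ := by
    have e : Z * N1 X Xp U pi * Zᵀ = (Z * R1 X Xp U) * fromBlocks (pi • (1 : Matrix (Fin n) (Fin n) ℝ)) 0 0
      (-1 : Matrix (Fin N) (Fin N) ℝ) * (Z * R1 X Xp U)ᵀ := by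
      simp only [N1, transpose_mul, Matrix.mul_assoc]
    rw [e, hZR1]
    simp [fromCols_mul_fromBlocks, transpose_fromCols, fromCols_mul_fromRows, sub_eq_add_neg]
  have hZR2 : Z * R2 n m = fromCols 1 (fromCols ΔA ΔB) := by
    simp only [hZ, R2, fromCols_mul_fromRows, mul_fromCols, Matrix.mul_zero, Matrix.mul_one,
      my_fc_add, add_zero, zero_add]
  have hZN2 : Z * N2 n m L T * Zᵀ = (L ^ 2 * (T : ℝ) ^ 2) • (1 : Matrix (Fin n) (Fin n) ℝ)
      - (ΔA * ΔAᵀ + ΔB * ΔBᵀ) := by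
    have e : Z * N2 n m L T * Zᵀ = (Z * R2 n m) *
      fromBlocks ((L ^ 2 * (T : ℝ) ^ 2) • (1 : Matrix (Fin n) (Fin n) ℝ)) 0 0
      (fromBlocks (-1 : Matrix (Fin n) (Fin n) ℝ) 0 0 (-1 : Matrix (Fin m) (Fin m) ℝ))
       * (Z * R2 n m)ᵀ := by
      simp only [N2, transpose_mul, Matrix.mul_assoc]
    rw [e, hZR2]
    simp [fromCols_mul_fromBlocks, transpose_fromCols, fromCols_mul_fromRows, sub_eq_add_neg]
    try abel
  have hG : (lam • Q - F * Q * Fᵀ).PosSemidef := by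
    have h := hLMI.mul_mul_conjTranspose_same Z
    rw [conjTranspose_eq_transpose_of_trivial, Matrix.mul_sub, Matrix.mul_sub, Matrix.sub_mul,
      Matrix.sub_mul, Matrix.mul_smul, Matrix.mul_smul, Matrix.smul_mul, Matrix.smul_mul,
      hZM, hZN1, hZN2] at h
    have h2 := (h.add (hW.smul hα₁)).add (hD.smul hα₂)
    convert h2 using 1
    abel
  have hlQ : (lam • Q).PosDef := hQ.smul hlam0
  have hQi : (Q⁻¹).PosDef := hQ.inv
  have : Invertible Q⁻¹ := hQi.isUnit.invertible
  have : Invertible (lam • Q) := hlQ.isUnit.invertible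
  have s1 := hQi.fromBlocks₁₁ Fᵀ (lam • Q)
  have s2 := Matrix.PosDef.fromBlocks₂₂ Q⁻¹ Fᵀ hlQ
  rw [conjTranspose_eq_transpose_of_trivial, transpose_transpose, nonsing_inv_nonsing_inv Q hdet] at s1
  rw [conjTranspose_eq_transpose_of_trivial, transpose_transpose] at s2
  have h3 := (s2.1 (s1.2 hG)).smul hlam0.le
  have hinv : (lam • Q)⁻¹ = lam⁻¹ • Q⁻¹ := by
    apply inv_eq_right_inv
    rw [Matrix.smul_mul, Matrix.mul_smul, mul_nonsing_inv Q hdet, smul_smul,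
      mul_inv_cancel₀ hlam0.ne', one_smul]
  rw [hinv, smul_sub, Matrix.mul_smul, Matrix.smul_mul, smul_smul, mul_inv_cancel₀ hlam0.ne',
    one_smul] at h3
  exact h3
end

section
/- Let x : ℕ → ℝⁿ, u : ℕ → ℝᵐ, A : ℕ → ℝ^{n×n}, B : ℕ → ℝ^{n×m} satisfy x(t+1) = A(t)x(t) + B(t)u(t) for all t, and suppose there is L ≥ 0 with ‖[A(t) − A(s), B(t) − B(s)]‖ ≤ L·|t − s| for all t, s ∈ ℕ. Fix t₀ ∈ ℕ and N ∈ ℕ₊ with N ≤ t₀, and define w(t) := (A(t) − A(t₀))x(t) + (B(t) − B(t₀))u(t), W := [w(t₀−N), w(t₀−N+1), …, w(t₀−1)] ∈ ℝ^{n×N}, X := [x(t₀−N), …, x(t₀−1)], X⁺ := [x(t₀−N+1), …, x(t₀)], U := [u(t₀−N), …, u(t₀−1)]. Then: (a) X⁺ = A(t₀)·X + B(t₀)·U + W, and (b) W·Wᵀ ⪯ L² · (Σ_{k=1}^{N} k² (‖x(t₀−k)‖² + ‖u(t₀−k)‖²)) · I_n. In particular, with π := L² Σ_{k=1}^{N}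 k² (‖x(t₀−k)‖² + ‖u(t₀−k)‖²) and Π := π I_n, the pair (A(t₀), B(t₀)) belongs to the set Σ of pairs consistent with the data (X, X⁺, U). -/
open Matrix
open scoped Matrix.Norms.L2Operator

theorem aux_norm {n m : ℕ} (P : Matrix (Fin n) (Fin n) ℝ) (Q : Matrix (Fin n) (Fin m) ℝ)
    (x : EuclideanSpace ℝ (Fin n)) (u : EuclideanSpace ℝ (Fin m)) (c : ℝ)
    (h : ‖fromCols P Q‖ ≤ c) :
    ‖toEuclideanLin P x + toEuclideanLin Q u‖ ^ 2 ≤ c ^ 2 * (‖x‖ ^ 2 + ‖u‖ ^ 2) := by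
  have h1 := Matrix.l2_opNorm_mulVec (fromCols P Q)
    (WithLp.toLp 2 (Sum.elim (x : Fin n → ℝ) (u : Fin m → ℝ)))
  have h2 : ‖(WithLp.toLp 2 (Sum.elim (x : Fin n → ℝ) (u : Fin m → ℝ)) :
      EuclideanSpace ℝ (Fin n ⊕ Fin m))‖ ^ 2 = ‖x‖ ^ 2 + ‖u‖ ^ 2 := by
    simp [EuclideanSpace.norm_sq_eq]
  have h3 : toEuclideanLin P x + toEuclideanLin Q u = WithLp.toLp 2
      (fromCols P Q *ᵥ (Sum.elim (x : Fin n → ℝ) (u : Fin m → ℝ))) := by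
    ext i
    simp [toEuclideanLin, toLpLin_apply, fromCols_mulVec]
  rw [h3, ← h2, ← mul_pow]
  refine pow_le_pow_left₀ (norm_nonneg _) (h1.trans ?_) 2
  gcongr

theorem aux_psd {n N : ℕ} (W : Matrix (Fin n) (Fin N) ℝ) (w : Fin N → EuclideanSpace ℝ (Fin n))
    (hW : W = of fun i j => w j i) (p : ℝ) (hp : ∑ j, ‖w j‖ ^ 2 ≤ p) :
    (p • (1 : Matrix (Fin n) (Fin n) ℝ) - W * Wᵀ).PosSemidef := by
  refine PosSemidef.of_dotProduct_mulVec_nonneg ?_ ?_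
  · simp [IsHermitian, conjTranspose_sub, conjTranspose_mul, conjTranspose_eq_transpose_of_trivial]
  · intro v
    have e1 : v ⬝ᵥ v = ‖(WithLp.toLp 2 v : EuclideanSpace ℝ (Fin n))‖ ^ 2 := by
      rw [EuclideanSpace.real_norm_sq_eq]
      simp [dotProduct, sq]
    have e2 : v ⬝ᵥ ((W * Wᵀ) *ᵥ v) =
        ∑ j, (inner ℝ (w j) (WithLp.toLp 2 v : EuclideanSpace ℝ (Fin n))) ^ 2 := by
      rw [← mulVec_mulVec, dotProduct_mulVec, ← mulVec_transpose]
      simp only [dotProduct]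
      refine Finset.sum_congr rfl fun j _ => ?_
      rw [← sq]
      congr 1
      simp [hW, mulVec, dotProduct, PiLp.inner_apply, mul_comm]
    have e3 : ∑ j, (inner ℝ (w j) (WithLp.toLp 2 v : EuclideanSpace ℝ (Fin n))) ^ 2 ≤
        (∑ j, ‖w j‖ ^ 2) * ‖(WithLp.toLp 2 v : EuclideanSpace ℝ (Fin n))‖ ^ 2 := by
      rw [Finset.sum_mul]
      refine Finset.sum_le_sum fun j _ => ?_
      rw [← mul_pow, ← sq_abs]
      exact pow_le_pow_left₀ (abs_nonneg _) (abs_real_inner_le_norm _ _) 2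
    have e4 := mul_le_mul_of_nonneg_right hp
      (sq_nonneg ‖(WithLp.toLp 2 v : EuclideanSpace ℝ (Fin n))‖)
    simp only [star_trivial, sub_mulVec, dotProduct_sub, smul_mulVec, one_mulVec,
      dotProduct_smul, smul_eq_mul]
    rw [e1, e2]
    linarith

/-- the stacked data equations and the bound on the virtual
disturbance stack `W`; in particular `(A(t₀), B(t₀))` is consistent with the data.
Vector norms are Euclidean; matrix norms are spectral (ℓ²-operator) norms;
the `j`-th column of `X` is `x(t₀−N+j)`, etc. -/
theorem data_consistency (n m N : ℕ) (hn : 0 < n) (hm : 0 < m) (hN : 0 < N)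
    (x : ℕ → EuclideanSpace ℝ (Fin n)) (u : ℕ → EuclideanSpace ℝ (Fin m))
    (A : ℕ → Matrix (Fin n) (Fin n) ℝ) (B : ℕ → Matrix (Fin n) (Fin m) ℝ)
    (hdyn : ∀ t, x (t + 1) = toEuclideanLin (A t) (x t) + toEuclideanLin (B t) (u t))
    (L : ℝ) (hL : 0 ≤ L)
    (hLip : ∀ t s : ℕ, ‖fromCols (A t - A s) (B t - B s)‖ ≤ L * |(t : ℝ) - (s : ℝ)|)
    (t₀ : ℕ) (hNt₀ : N ≤ t₀)
    (X Xp : Matrix (Fin n) (Fin N) ℝ) (U : Matrix (Fin m) (Fin N) ℝ)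
    (W : Matrix (Fin n) (Fin N) ℝ)
    (hX : X = of fun i (j : Fin N) => x (t₀ - N + j) i)
    (hXp : Xp = of fun i (j : Fin N) => x (t₀ - N + j + 1) i)
    (hU : U = of fun i (j : Fin N) => u (t₀ - N + j) i)
    (hW : W = of fun i (j : Fin N) =>
      (toEuclideanLin (A (t₀ - N + j) - A t₀) (x (t₀ - N + j))
        + toEuclideanLin (B (t₀ - N + j) - B t₀) (u (t₀ - N + j))) i) :
    Xp = A t₀ * X + B t₀ * U + W ∧
    ((L ^ 2 * ∑ k ∈ Finset.Icc 1 N, (k : ℝ) ^ 2 * (‖x (t₀ - k)‖ ^ 2 + ‖u (t₀ - k)‖ ^ 2)) •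
        (1 : Matrix (Fin n) (Fin n) ℝ) - W * Wᵀ).PosSemidef ∧
    memSigma X Xp U
      (L ^ 2 * ∑ k ∈ Finset.Icc 1 N, (k : ℝ) ^ 2 * (‖x (t₀ - k)‖ ^ 2 + ‖u (t₀ - k)‖ ^ 2))
      (A t₀) (B t₀) := by
  have ha : Xp = A t₀ * X + B t₀ * U + W := by
    subst hX hXp hU hW
    ext i j
    simp only [of_apply, hdyn]
    simp [toEuclideanLin, toLpLin_apply, sub_mulVec, mul_apply, mulVec, dotProduct]
    ring
  have hb : ((L ^ 2 * ∑ k ∈ Finset.Icc 1 N,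
      (k : ℝ) ^ 2 * (‖x (t₀ - k)‖ ^ 2 + ‖u (t₀ - k)‖ ^ 2)) •
        (1 : Matrix (Fin n) (Fin n) ℝ) - W * Wᵀ).PosSemidef := by
    refine aux_psd W _ hW _ ?_
    have hs : ∑ k ∈ Finset.Icc 1 N, (k : ℝ) ^ 2 * (‖x (t₀ - k)‖ ^ 2 + ‖u (t₀ - k)‖ ^ 2) =
        ∑ j : Fin N, ((N - j : ℕ) : ℝ) ^ 2 *
          (‖x (t₀ - N + j)‖ ^ 2 + ‖u (t₀ - N + j)‖ ^ 2) := by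
      symm
      refine Finset.sum_bij (fun (j : Fin N) _ => N - (j : ℕ)) ?_ ?_ ?_ ?_
      · intro j _
        have := j.2
        simp only [Finset.mem_Icc]
        omega
      · intro j _ k _ h
        have := j.2
        have := k.2
        ext
        omega
      · intro k hk
        simp only [Finset.mem_Icc] at hk
        exact ⟨⟨N - k, by omega⟩, Finset.mem_univ _, by simp only; omega⟩
      · intro j _
        have := j.2
        have e : t₀ - (N - (j : ℕ)) = t₀ - N + j := by omega
        simp only [e]
    rw [hs, Finset.mul_sum]
    refine Finset.sum_le_sum fun j _ => ?_
    rw [← mul_assoc, ← mul_pow]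
    refine aux_norm _ _ _ _ _ ((hLip _ _).trans (le_of_eq ?_))
    have hj := j.2
    congr 1
    have e : (t₀ : ℝ) = ((t₀ - N + j : ℕ) : ℝ) + ((N - j : ℕ) : ℝ) := by
      rw [← Nat.cast_add]
      congr 1
      omega
    rw [e, abs_sub_comm, add_sub_cancel_left, Nat.abs_cast]
  exact ⟨ha, hb, W, ha, hb⟩
end

section
/- Let x : ℕ → ℝⁿ, u : ℕ → ℝᵐ, A : ℕ → ℝ^{n×n}, B : ℕ → ℝ^{n×m} satisfy x(t+1) = A(t)x(t) + B(t)u(t) for all t, with ‖[A(t) − A(s), B(t) − B(s)]‖ ≤ L·|t − s| for all t, s ∈ ℕ and some L ≥ 0. Fix t₀ ∈ ℕ, N ∈ ℕ₊ with N ≤ t₀, and T ∈ ℕ₊, and define the data matrices X := [x(t₀−N), …, x(t₀−1)], X⁺ := [x(t₀−N+1), …, x(t₀)], U := [u(t₀−N), …, u(t₀−1)], the scalar π := L² Σ_{k=1}^{N} k² (‖x(t₀−k)‖² + ‖u(t₀−k)‖²), Π := π·I_n, and the matrices M, N₁, N₂ built from these data and a fixed λ ∈ (0,1). If there exist α₁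 ≥ 0, α₂ ≥ 0, a positive definite Q ∈ ℝ^{n×n} and L₀ ∈ ℝ^{m×n} with M − α₁ N₁ − α₂ N₂ ⪰ 0, then with K := L₀ Q⁻¹ and P := Q⁻¹, for every t with t₀ ≤ t < t₀ + T it holds that (A(t) + B(t)K)ᵀ P (A(t) + B(t)K) ⪯ λ P. -/
open Matrix
open scoped Matrix.Norms.L2Operator

lemma aux_norm_s15 {p q : Type*} [Fintype p] [Fintype q] [DecidableEq p] [DecidableEq q]
    (G : Matrix p q ℝ) (c : ℝ) (h : ‖G‖ ≤ c) (z : q → ℝ) :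
    (G *ᵥ z) ⬝ᵥ (G *ᵥ z) ≤ c ^ 2 * (z ⬝ᵥ z) := by
  have key := Matrix.l2_opNorm_mulVec G (WithLp.toLp 2 z)
  have h2 : ‖WithLp.toLp 2 (G *ᵥ z)‖ ≤ c * ‖WithLp.toLp 2 z‖ :=
    key.trans (mul_le_mul_of_nonneg_right h (norm_nonneg _))
  have h3 := pow_le_pow_left₀ (norm_nonneg _) h2 2
  rw [mul_pow, EuclideanSpace.real_norm_sq_eq, EuclideanSpace.real_norm_sq_eq] at h3
  simpa [dotProduct, pow_two] using h3

lemma aux_psd_s15 {p q : Type*} [Fintype p] [Fintype q] [DecidableEq p]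
    (G : Matrix p q ℝ) (c : ℝ)
    (h : ∀ v : p → ℝ, (Gᵀ *ᵥ v) ⬝ᵥ (Gᵀ *ᵥ v) ≤ c * (v ⬝ᵥ v)) :
    (c • (1 : Matrix p p ℝ) - G * Gᵀ).PosSemidef := by
  refine Matrix.PosSemidef.of_dotProduct_mulVec_nonneg ?_ ?_
  · simp [Matrix.IsHermitian, Matrix.transpose_mul]
  · intro v
    have := h v
    have e : v ⬝ᵥ ((G * Gᵀ) *ᵥ v) = (Gᵀ *ᵥ v) ⬝ᵥ (Gᵀ *ᵥ v) := by
      rw [← Matrix.mulVec_mulVec, Matrix.dotProduct_mulVec, Matrix.mulVec_transpose]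
    simp only [star_trivial, Matrix.sub_mulVec, dotProduct_sub, Matrix.smul_mulVec,
      Matrix.one_mulVec, dotProduct_smul, smul_eq_mul, e]
    linarith

lemma aux_psd_norm {p q : Type*} [Fintype p] [Fintype q] [DecidableEq p] [DecidableEq q]
    (G : Matrix p q ℝ) (c : ℝ) (h : ‖G‖ ≤ c) :
    (c ^ 2 • (1 : Matrix p p ℝ) - G * Gᵀ).PosSemidef := by
  refine aux_psd_s15 _ _ fun v => aux_norm_s15 Gᵀ c ?_ v
  have := Matrix.l2_opNorm_conjTranspose G
  rw [Matrix.conjTranspose_eq_transpose_of_trivial] at this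
  rwa [this]

lemma aux_psd_cols {p q : Type*} [Fintype p] [Fintype q] [DecidableEq p]
    (W : Matrix p q ℝ) (c : ℝ) (h : ∑ j, ∑ i, W i j ^ 2 ≤ c) :
    (c • (1 : Matrix p p ℝ) - W * Wᵀ).PosSemidef := by
  refine aux_psd_s15 _ _ fun v => ?_
  have hv : 0 ≤ v ⬝ᵥ v := by
    simpa [dotProduct] using Finset.sum_nonneg fun i _ => mul_self_nonneg (v i)
  refine le_trans ?_ (mul_le_mul_of_nonneg_right h hv)
  rw [Finset.sum_mul]
  unfold dotProduct
  refine Finset.sum_le_sum fun j _ => ?_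
  have := Finset.sum_mul_sq_le_sq_mul_sq Finset.univ (fun i => W i j) v
  simpa [Matrix.mulVec, dotProduct, pow_two] using this

lemma aux_schur {n : ℕ} (lam : ℝ) (hlam0 : 0 < lam) (Q F : Matrix (Fin n) (Fin n) ℝ)
    (hQ : Q.PosDef) (h : (lam • Q - F * Q * Fᵀ).PosSemidef) :
    (lam • Q⁻¹ - Fᵀ * Q⁻¹ * F).PosSemidef := by
  have hdet : IsUnit Q.det := hQ.det_pos.ne'.isUnit
  have hP : (Q⁻¹).PosDef := hQ.inv
  have hlQ : (lam • Q).PosDef := hQ.smul hlam0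
  haveI : Invertible Q⁻¹ := hP.isUnit.invertible
  haveI : Invertible (lam • Q) := hlQ.isUnit.invertible
  have h1 : (fromBlocks (lam • Q) F Fᴴ Q⁻¹).PosSemidef := by
    rw [Matrix.PosDef.fromBlocks₂₂ _ _ hP, Matrix.nonsing_inv_nonsing_inv _ hdet]
    simpa using h
  rw [Matrix.PosDef.fromBlocks₁₁ _ _ hlQ] at h1
  have h2 := h1.smul hlam0.le
  have e : (lam • Q)⁻¹ = lam⁻¹ • Q⁻¹ := by
    apply Matrix.inv_eq_right_inv
    simp [Matrix.mul_nonsing_inv _ hdet, smul_smul, hlam0.ne']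
  rw [e] at h2
  simpa [smul_sub, smul_smul, hlam0.ne'] using h2

/-- The multiplier `[I; Aᵀ; Bᵀ; Dᵀ; Eᵀ]`. -/
noncomputable def Zm {n m : ℕ} (A D : Matrix (Fin n) (Fin n) ℝ) (B E : Matrix (Fin n) (Fin m) ℝ) :
    Matrix (Fin n ⊕ (Fin n ⊕ (Fin m ⊕ (Fin n ⊕ Fin m)))) (Fin n) ℝ :=
  fromRows 1 (fromRows Aᵀ (fromRows Bᵀ (fromRows Dᵀ Eᵀ)))

lemma Zm_transpose {n m : ℕ} (A D : Matrix (Fin n) (Fin n) ℝ) (B E : Matrix (Fin n) (Fin m) ℝ) :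
    (Zm A D B E)ᵀ = fromCols 1 (fromCols A (fromCols B (fromCols D E))) := by
  simp [Zm, transpose_fromRows]

lemma Z_C {n m : ℕ} (A D : Matrix (Fin n) (Fin n) ℝ) (B E : Matrix (Fin n) (Fin m) ℝ)
    (Q : Matrix (Fin n) (Fin n) ℝ) (L₀ : Matrix (Fin m) (Fin n) ℝ) :
    (Zm A D B E)ᵀ * Cblk Q L₀ = (A + D) * Q + (B + E) * L₀ := by
  rw [Zm_transpose, Cblk]
  simp only [fromCols_mul_fromRows]
  simp only [Matrix.add_mul, Matrix.mul_zero, zero_add]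
  abel

lemma Z_R1 {n m N : ℕ} (A D : Matrix (Fin n) (Fin n) ℝ) (B E : Matrix (Fin n) (Fin m) ℝ)
    (X Xp : Matrix (Fin n) (Fin N) ℝ) (U : Matrix (Fin m) (Fin N) ℝ) :
    (Zm A D B E)ᵀ * R1 X Xp U = fromCols 1 (Xp - A * X - B * U) := by
  rw [Zm_transpose, R1]
  simp only [fromCols_mul_fromRows, mul_fromCols]
  ext i (j | j) <;> simp
  ring

lemma Z_R2 {n m : ℕ} (A D : Matrix (Fin n) (Fin n) ℝ) (B E : Matrix (Fin n) (Fin m) ℝ) :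
    (Zm A D B E)ᵀ * R2 n m = fromCols 1 (fromCols D E) := by
  rw [Zm_transpose, R2]
  simp only [fromCols_mul_fromRows, mul_fromCols]
  ext i (j | j | j) <;> simp

lemma Z_sandwich {a b c : Type*} [Fintype a] [Fintype b] [Fintype c]
    (Z : Matrix a b ℝ) (R : Matrix a c ℝ) (S : Matrix c c ℝ) :
    Zᵀ * (R * S * Rᵀ) * Z = (Zᵀ * R) * S * (Zᵀ * R)ᵀ := by
  simp [Matrix.transpose_mul, Matrix.mul_assoc]

lemma Z_M {n m : ℕ} (A D : Matrix (Fin n) (Fin n) ℝ) (B E : Matrix (Fin n) (Fin m) ℝ)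
    (lam : ℝ) (Q : Matrix (Fin n) (Fin n) ℝ) (hQ : Q.PosDef) (L₀ : Matrix (Fin m) (Fin n) ℝ) :
    (Zm A D B E)ᵀ * Mmat lam Q L₀ * Zm A D B E =
      lam • Q - (A + D + (B + E) * (L₀ * Q⁻¹)) * Q * (A + D + (B + E) * (L₀ * Q⁻¹))ᵀ := by
  have hdet : IsUnit Q.det := hQ.det_pos.ne'.isUnit
  rw [Mmat, Matrix.mul_sub, Matrix.sub_mul, Z_sandwich, Z_C]
  have e : (A + D) * Q + (B + E) * L₀ = (A + D + (B + E) * (L₀ * Q⁻¹)) * Q := by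
    rw [Matrix.add_mul (A + D) ((B + E) * (L₀ * Q⁻¹)) Q, Matrix.mul_assoc (B + E), Matrix.mul_assoc L₀,
      Matrix.nonsing_inv_mul _ hdet, Matrix.mul_one]
  rw [e]
  have hs : Qᵀ = Q := by simpa using hQ.isHermitian.eq
  congr 1
  · rw [Zm_transpose, Zm]
    simp [fromCols_mul_fromBlocks, fromCols_mul_fromRows]
  · rw [Matrix.mul_assoc _ Q, Matrix.mul_nonsing_inv _ hdet, Matrix.mul_one,
      Matrix.transpose_mul, hs, Matrix.mul_assoc]

lemma Z_N1 {n m N : ℕ} (A D : Matrix (Fin n) (Fin n) ℝ) (B E : Matrix (Fin n) (Fin m) ℝ)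
    (X Xp : Matrix (Fin n) (Fin N) ℝ) (U : Matrix (Fin m) (Fin N) ℝ) (pi : ℝ) :
    (Zm A D B E)ᵀ * N1 X Xp U pi * Zm A D B E =
      pi • (1 : Matrix (Fin n) (Fin n) ℝ) - (Xp - A * X - B * U) * (Xp - A * X - B * U)ᵀ := by
  rw [N1, Z_sandwich, Z_R1, transpose_fromCols, fromCols_mul_fromBlocks, fromCols_mul_fromRows]
  generalize Xp - A * X - B * U = W
  simp [sub_eq_add_neg]

lemma Z_N2 {n m : ℕ} (A D : Matrix (Fin n) (Fin n) ℝ) (B E : Matrix (Fin n) (Fin m) ℝ)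
    (L : ℝ) (T : ℕ) :
    (Zm A D B E)ᵀ * N2 n m L T * Zm A D B E =
      (L * T) ^ 2 • (1 : Matrix (Fin n) (Fin n) ℝ) - fromCols D E * (fromCols D E)ᵀ := by
  have h : fromBlocks (-1 : Matrix (Fin n) (Fin n) ℝ) 0 0 (-1 : Matrix (Fin m) (Fin m) ℝ)
      = -1 := by
    rw [← fromBlocks_one, fromBlocks_neg]; simp
  rw [N2, Z_sandwich, Z_R2, transpose_fromCols, fromCols_mul_fromBlocks, fromCols_mul_fromRows, h]
  generalize fromCols D E = W
  simp [sub_eq_add_neg, mul_pow]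

/-- functionality of the ODDAC gain computation: the gain computed
from data over the window `{t₀−N, …, t₀−1}` yields a Lyapunov decrease along the true
time-varying system for the next `T` steps. Vector norms are Euclidean, matrix norms
spectral; the `j`-th column of `X` is `x(t₀−N+j)`, etc. -/
theorem oddac_gain_guarantee (n m N : ℕ) (hn : 0 < n) (hm : 0 < m) (hN : 0 < N)
    (x : ℕ → EuclideanSpace ℝ (Fin n)) (u : ℕ → EuclideanSpace ℝ (Fin m))
    (A : ℕ → Matrix (Fin n) (Fin n) ℝ) (B : ℕ → Matrix (Fin n) (Fin m) ℝ)
    (hdyn : ∀ t, x (t + 1) = toEuclideanLin (A t) (x t) + toEuclideanLin (B t) (u t))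
    (L : ℝ) (hL : 0 ≤ L)
    (hLip : ∀ t s : ℕ, ‖fromCols (A t - A s) (B t - B s)‖ ≤ L * |(t : ℝ) - (s : ℝ)|)
    (t₀ : ℕ) (hNt₀ : N ≤ t₀) (T : ℕ) (hT : 0 < T)
    (X Xp : Matrix (Fin n) (Fin N) ℝ) (U : Matrix (Fin m) (Fin N) ℝ)
    (hX : X = of fun i (j : Fin N) => x (t₀ - N + j) i)
    (hXp : Xp = of fun i (j : Fin N) => x (t₀ - N + j + 1) i)
    (hU : U = of fun i (j : Fin N) => u (t₀ - N + j) i)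
    (pi : ℝ)
    (hpi : pi = L ^ 2 * ∑ k ∈ Finset.Icc 1 N,
      (k : ℝ) ^ 2 * (‖x (t₀ - k)‖ ^ 2 + ‖u (t₀ - k)‖ ^ 2))
    (lam : ℝ) (hlam0 : 0 < lam) (hlam1 : lam < 1)
    (α₁ α₂ : ℝ) (hα₁ : 0 ≤ α₁) (hα₂ : 0 ≤ α₂)
    (Q : Matrix (Fin n) (Fin n) ℝ) (hQ : Q.PosDef)
    (L₀ : Matrix (Fin m) (Fin n) ℝ)
    (hLMI : (Mmat lam Q L₀ - α₁ • N1 X Xp U pi - α₂ • N2 n m L T).PosSemidef) :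
    ∀ t : ℕ, t₀ ≤ t → t < t₀ + T →
      (lam • Q⁻¹ - (A t + B t * (L₀ * Q⁻¹))ᵀ * Q⁻¹
        * (A t + B t * (L₀ * Q⁻¹))).PosSemidef := by
  intro t ht0 ht1
  apply aux_schur lam hlam0 Q _ hQ
  have h0 := hLMI.conjTranspose_mul_mul_same (Zm (A t₀) (A t - A t₀) (B t₀) (B t - B t₀))
  rw [Matrix.conjTranspose_eq_transpose_of_trivial, Matrix.mul_sub, Matrix.mul_sub,
    Matrix.sub_mul, Matrix.sub_mul, Matrix.mul_smul, Matrix.mul_smul, Matrix.smul_mul,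
    Matrix.smul_mul, Z_M _ _ _ _ _ _ hQ, Z_N1, Z_N2, add_sub_cancel, add_sub_cancel] at h0
  have h2 : ((L * T) ^ 2 • (1 : Matrix (Fin n) (Fin n) ℝ)
      - fromCols (A t - A t₀) (B t - B t₀) * (fromCols (A t - A t₀) (B t - B t₀))ᵀ).PosSemidef := by
    apply aux_psd_norm
    refine (hLip t t₀).trans (mul_le_mul_of_nonneg_left ?_ hL)
    have a1 : (t₀ : ℝ) ≤ t := by exact_mod_cast ht0
    have a2 : (t : ℝ) ≤ t₀ + T := by exact_mod_cast ht1.le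
    rw [abs_of_nonneg (by linarith)]
    linarith
  have h1 : (pi • (1 : Matrix (Fin n) (Fin n) ℝ)
      - (Xp - A t₀ * X - B t₀ * U) * (Xp - A t₀ * X - B t₀ * U)ᵀ).PosSemidef := by
    apply aux_psd_cols
    have hcol : ∀ j : Fin N, ∑ i, (Xp - A t₀ * X - B t₀ * U) i j ^ 2 ≤
        (L * ((N - j : ℕ) : ℝ)) ^ 2 *
          (‖x (t₀ - (N - j))‖ ^ 2 + ‖u (t₀ - (N - j))‖ ^ 2) := by
      intro j
      have hj := j.2
      have hs : t₀ - (N - j) = t₀ - N + j := by omega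
      rw [hs]
      have hb : ‖fromCols (A (t₀ - N + j) - A t₀) (B (t₀ - N + j) - B t₀)‖
          ≤ L * ((N - j : ℕ) : ℝ) := by
        refine (hLip _ _).trans (le_of_eq ?_)
        congr 1
        have c : ((t₀ - N + j : ℕ) : ℝ) - (t₀ : ℝ) = -((N - j : ℕ) : ℝ) := by
          have : (t₀ - N + j) + (N - j) = t₀ := by omega
          have h' : ((t₀ - N + j : ℕ) : ℝ) + ((N - j : ℕ) : ℝ) = (t₀ : ℝ) := by exact_mod_cast this
          linarith
        rw [c, abs_neg, abs_of_nonneg (Nat.cast_nonneg _)]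
      have key := aux_norm_s15 _ _ hb (Sum.elim (x (t₀ - N + j)).ofLp (u (t₀ - N + j)).ofLp)
      rw [fromCols_mulVec_sumElim] at key
      have e1 : ∀ i, (Xp - A t₀ * X - B t₀ * U) i j =
          ((A (t₀ - N + j) - A t₀) *ᵥ (x (t₀ - N + j)).ofLp
            + (B (t₀ - N + j) - B t₀) *ᵥ (u (t₀ - N + j)).ofLp) i := by
        intro i
        have hd := congrArg (fun z : EuclideanSpace ℝ (Fin n) => z i) (hdyn (t₀ - N + j))
        subst hX hXp hU
        simp only [Matrix.sub_apply, Matrix.of_apply]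
        rw [hd]
        simp [Matrix.sub_mulVec, Matrix.mul_apply, Matrix.mulVec, dotProduct]
        ring
      simp only [e1, EuclideanSpace.real_norm_sq_eq]
      simpa [dotProduct, Fintype.sum_sum_type, pow_two] using key
    refine (Finset.sum_le_sum fun j _ => hcol j).trans (le_of_eq ?_)
    rw [hpi, Finset.mul_sum,
      Fin.sum_univ_eq_sum_range (fun j => (L * ((N - j : ℕ) : ℝ)) ^ 2 *
          (‖x (t₀ - (N - j))‖ ^ 2 + ‖u (t₀ - (N - j))‖ ^ 2)) N]
    refine Finset.sum_bij' (fun j _ => N - j) (fun k _ => N - k) ?_ ?_ ?_ ?_ ?_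
    · intro j hj; simp only [Finset.mem_range, Finset.mem_Icc] at *; omega
    · intro j hj; simp only [Finset.mem_range, Finset.mem_Icc] at *; omega
    · intro j hj; simp only [Finset.mem_range, Finset.mem_Icc] at *; omega
    · intro j hj; simp only [Finset.mem_range, Finset.mem_Icc] at *; omega
    · intro j hj; ring
  have h3 := (h0.add (h1.smul hα₁)).add (h2.smul hα₂)
  convert h3 using 1
  abel
end
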